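/- For a standard scalar Gaussian x ~ N(0,1) and any real numbers a, b: √(2/π)·√(E[(a+bx)²]) ≤ E[|a+bx|] ≤ √(E[(a+bx)²]), with the lower bound achieved with equality exactly when a = 0 (and b arbitrary). -/

import Mathlib

open MeasureTheory ProbabilityTheory

/-- The primitive `D a = ∫₀^a e^{-x²/2}`. -/
noncomputable def gD (a : ℝ) : ℝ := ∫ x in (0:ℝ)..a, Real.exp (-(1/2) * x ^ 2)

lemma gD_hasDerivAt (a : ℝ) : HasDerivAt gD (Real.exp (-(1/2) * a ^ 2)) a := by
  have hc : Continuous fun x : ℝ => Real.exp (-(1/2) * x ^ 2) := by fun_prop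
  exact intervalIntegral.integral_hasDerivAt_right (hc.intervalIntegrable _ _)
    (hc.stronglyMeasurableAtFilter _ _) hc.continuousAt

lemma gD_zero : gD 0 = 0 := by simp [gD]

lemma gD_neg (a : ℝ) : gD (-a) = - gD a := by
  unfold gD
  have h := intervalIntegral.integral_comp_neg (a := 0) (b := a)
    (fun x : ℝ => Real.exp (-(1/2) * x ^ 2))
  simp only [neg_zero, neg_sq] at h
  rw [intervalIntegral.integral_symm, ← h]

lemma g_hasDerivAt (a : ℝ) :
    HasDerivAt (fun x : ℝ => Real.exp (-(1/2) * x ^ 2)) (-a * Real.exp (-(1/2) * a ^ 2)) a := by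
  have h := ((hasDerivAt_pow 2 a).const_mul (-(1/2) : ℝ)).exp
  refine h.congr_deriv ?_
  push_cast
  ring

lemma aux_pos {a : ℝ} (ha : 0 < a) : 0 < gD a - a * Real.exp (-(1/2) * a ^ 2) := by
  have hd : ∀ x : ℝ, HasDerivAt (fun x : ℝ => gD x - x * Real.exp (-(1/2) * x ^ 2))
      (x ^ 2 * Real.exp (-(1/2) * x ^ 2)) x := by
    intro x
    refine ((gD_hasDerivAt x).sub ((hasDerivAt_id' x).mul (g_hasDerivAt x))).congr_deriv ?_
    ring
  have hm : StrictMonoOn (fun x : ℝ => gD x - x * Real.exp (-(1/2) * x ^ 2)) (Set.Ici 0) := by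
    apply strictMonoOn_of_deriv_pos (convex_Ici 0)
    · exact fun x _ => (hd x).continuousAt.continuousWithinAt
    · intro x hx
      rw [interior_Ici, Set.mem_Ioi] at hx
      rw [(hd x).deriv]
      positivity
  have := hm (Set.mem_Ici.2 le_rfl) (Set.mem_Ici.2 ha.le) ha
  simpa [gD_zero] using this

lemma main_pos {a : ℝ} (ha : 0 < a) :
    Real.sqrt (1 + a ^ 2) < a * gD a + Real.exp (-(1/2) * a ^ 2) := by
  have hs : ∀ x : ℝ, 0 < Real.sqrt (1 + x ^ 2) := fun x => Real.sqrt_pos.2 (by positivity)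
  have hd : ∀ x : ℝ, HasDerivAt
      (fun x : ℝ => (x * gD x + Real.exp (-(1/2) * x ^ 2)) / Real.sqrt (1 + x ^ 2))
      ((gD x - x * Real.exp (-(1/2) * x ^ 2)) / Real.sqrt (1 + x ^ 2) ^ 3) x := by
    intro x
    have h1 : HasDerivAt (fun x : ℝ => 1 + x ^ 2) (2 * x) x := by
      simpa using ((hasDerivAt_id x).pow 2).const_add 1
    have h2 := h1.sqrt (by positivity)
    have h3 := (((hasDerivAt_id' x).mul (gD_hasDerivAt x)).add (g_hasDerivAt x)).div h2 (hs x).ne'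
    refine h3.congr_deriv ?_
    have hsq : Real.sqrt (1 + x ^ 2) ^ 2 = 1 + x ^ 2 := Real.sq_sqrt (by positivity)
    have := (hs x).ne'
    simp only [Pi.mul_apply, Pi.add_apply]
    generalize Real.exp (-(1/2) * x ^ 2) = e at *
    generalize Real.sqrt (1 + x ^ 2) = s at *
    field_simp
    rw [hsq]
    ring
  have hm : StrictMonoOn
      (fun x : ℝ => (x * gD x + Real.exp (-(1/2) * x ^ 2)) / Real.sqrt (1 + x ^ 2))
      (Set.Ici 0) := by
    apply strictMonoOn_of_deriv_pos (convex_Ici 0)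
    · exact fun x _ => (hd x).continuousAt.continuousWithinAt
    · intro x hx
      rw [interior_Ici, Set.mem_Ioi] at hx
      rw [(hd x).deriv]
      exact div_pos (aux_pos hx) (pow_pos (hs x) 3)
  have := hm (Set.mem_Ici.2 le_rfl) (Set.mem_Ici.2 ha.le) ha
  simp only [zero_mul, zero_add] at this
  rw [lt_div_iff₀ (hs a)] at this
  simpa using this

lemma main_ne {a : ℝ} (ha : a ≠ 0) :
    Real.sqrt (1 + a ^ 2) < a * gD a + Real.exp (-(1/2) * a ^ 2) := by
  rcases lt_or_gt_of_ne ha with h | h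
  · have := main_pos (neg_pos.2 h)
    simpa [gD_neg] using this
  · exact main_pos h

lemma int_g : Integrable fun x : ℝ => Real.exp (-(1/2) * x ^ 2) :=
  integrable_exp_neg_mul_sq (by norm_num)

lemma int_xg : Integrable fun x : ℝ => x * Real.exp (-(1/2) * x ^ 2) :=
  integrable_mul_exp_neg_mul_sq (by norm_num)

lemma tendsto_g_top : Filter.Tendsto (fun x : ℝ => Real.exp (-(1/2) * x ^ 2))
    Filter.atTop (nhds 0) := by
  apply Real.tendsto_exp_atBot.comp
  exact Filter.Tendsto.const_mul_atTop_of_neg (by norm_num)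
    (Filter.tendsto_pow_atTop (by norm_num))

lemma int_Ioi_xg (c : ℝ) : ∫ x in Set.Ioi c, x * Real.exp (-(1/2) * x ^ 2) =
    Real.exp (-(1/2) * c ^ 2) := by
  have h := integral_Ioi_of_hasDerivAt_of_tendsto' (a := c)
    (f := fun x : ℝ => - Real.exp (-(1/2) * x ^ 2))
    (f' := fun x : ℝ => x * Real.exp (-(1/2) * x ^ 2)) (m := 0)
    (fun x _ => (g_hasDerivAt x).neg.congr_deriv (by ring))
    int_xg.integrableOn (by simpa using tendsto_g_top.neg)
  rw [h]; simp

lemma int_Ioi_g (c : ℝ) : ∫ x in Set.Ioi c, Real.exp (-(1/2) * x ^ 2) =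
    Real.sqrt (2 * Real.pi) / 2 - gD c := by
  have h0 : ∫ x in Set.Ioi (0:ℝ), Real.exp (-(1/2) * x ^ 2) = Real.sqrt (2 * Real.pi) / 2 := by
    rw [integral_gaussian_Ioi]; congr 2; ring
  have h1 := intervalIntegral.integral_interval_add_Ioi (a := 0) (b := c)
    (f := fun x : ℝ => Real.exp (-(1/2) * x ^ 2)) int_g.integrableOn int_g.integrableOn
  rw [h0] at h1
  unfold gD
  linarith

lemma int_abs (c : ℝ) : ∫ x, |c + x| * Real.exp (-(1/2) * x ^ 2) =
    2 * (c * gD c + Real.exp (-(1/2) * c ^ 2)) := by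
  have hI : Integrable fun x : ℝ => (c + x) * Real.exp (-(1/2) * x ^ 2) := by
    simp only [add_mul]
    exact (int_g.const_mul c).add int_xg
  have hA : ∀ d : ℝ, ∫ x in Set.Ioi d, (c + x) * Real.exp (-(1/2) * x ^ 2) =
      c * (Real.sqrt (2 * Real.pi) / 2 - gD d) + Real.exp (-(1/2) * d ^ 2) := by
    intro d
    simp only [add_mul]
    rw [integral_add (int_g.const_mul c).integrableOn int_xg.integrableOn, integral_const_mul,
      int_Ioi_g, int_Ioi_xg]
  have hT : ∫ x, (c + x) * Real.exp (-(1/2) * x ^ 2) = c * Real.sqrt (2 * Real.pi) := by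
    simp only [add_mul]
    rw [integral_add (int_g.const_mul c) int_xg, integral_const_mul, integral_gaussian]
    have h0 : ∫ x : ℝ, x * Real.exp (-(1/2) * x ^ 2) = 0 := by
      have h := integral_neg_eq_self (fun x : ℝ => x * Real.exp (-(1/2) * x ^ 2)) volume
      simp only [neg_sq, neg_mul, integral_neg] at h
      simp only [neg_mul]
      linarith
    rw [h0, add_zero]; congr 2; ring
  have hpt : ∀ x : ℝ, |c + x| * Real.exp (-(1/2) * x ^ 2) =
      2 * (Set.Ioi (-c)).indicator (fun x => (c + x) * Real.exp (-(1/2) * x ^ 2)) x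
        - (c + x) * Real.exp (-(1/2) * x ^ 2) := by
    intro x
    by_cases h : -c < x
    · rw [Set.indicator_of_mem (Set.mem_Ioi.2 h), abs_of_pos (by linarith)]; ring
    · rw [Set.indicator_of_notMem (by simpa using h), abs_of_nonpos (by linarith)]; ring
  simp_rw [hpt]
  rw [integral_sub ((hI.indicator measurableSet_Ioi).const_mul 2) hI, integral_const_mul,
    integral_indicator measurableSet_Ioi, hA, hT, gD_neg, neg_sq]
  ring

lemma gauss_abs (c : ℝ) : ∫ x, |c + x| ∂(gaussianReal 0 1) =
    Real.sqrt (2 / Real.pi) * (c * gD c + Real.exp (-(1/2) * c ^ 2)) := by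
  rw [integral_gaussianReal_eq_integral_smul one_ne_zero]
  have : ∀ x : ℝ, gaussianPDFReal 0 1 x • |c + x| =
      (Real.sqrt (2 * Real.pi))⁻¹ * (|c + x| * Real.exp (-(1/2) * x ^ 2)) := by
    intro x
    simp only [gaussianPDFReal, smul_eq_mul, sub_zero, NNReal.coe_one, mul_one]
    rw [show -x ^ 2 / 2 = -(1/2) * x ^ 2 by ring]
    ring
  simp_rw [this]
  rw [integral_const_mul, int_abs, ← mul_assoc]
  congr 1
  rw [Real.sqrt_mul (by norm_num), Real.sqrt_div (by norm_num)]
  have h2 : Real.sqrt 2 ^ 2 = 2 := Real.sq_sqrt (by norm_num)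
  have : Real.sqrt Real.pi ≠ 0 := (Real.sqrt_pos.2 Real.pi_pos).ne'
  field_simp
  rw [h2]

lemma gauss_memLp (a b : ℝ) : MemLp (fun x : ℝ => a + b * x) 2 (gaussianReal 0 1) :=
  (memLp_const a).add ((memLp_id_gaussianReal' 2 (by norm_num)).const_mul b)

lemma gauss_sq (a b : ℝ) : ∫ x, (a + b * x) ^ 2 ∂(gaussianReal 0 1) = a ^ 2 + b ^ 2 := by
  have hid : MemLp (fun x : ℝ => x) 2 (gaussianReal 0 1) :=
    memLp_id_gaussianReal' 2 (by norm_num)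
  have h1 : Integrable (fun x : ℝ => x) (gaussianReal 0 1) := hid.integrable (by norm_num)
  have h2 : Integrable (fun x : ℝ => x ^ 2) (gaussianReal 0 1) := hid.integrable_sq
  have hv := variance_fun_id_gaussianReal (μ := 0) (v := 1)
  rw [variance_eq_sub hid] at hv
  simp at hv
  have : ∀ x : ℝ, (a + b * x) ^ 2 = a ^ 2 + ((2 * a * b) * x + b ^ 2 * x ^ 2) := by
    intro x; ring
  simp_rw [this]
  have h3 : Integrable (fun x : ℝ => (2 * a * b) * x + b ^ 2 * x ^ 2) (gaussianReal 0 1) :=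
    (h1.const_mul _).add (h2.const_mul _)
  rw [integral_add (integrable_const _) h3,
    integral_add (h1.const_mul _) (h2.const_mul _), integral_const_mul, integral_const_mul, hv]
  simp

lemma gauss_upper (a b : ℝ) : (∫ x, |a + b * x| ∂(gaussianReal 0 1)) ≤
      Real.sqrt (∫ x, (a + b * x) ^ 2 ∂(gaussianReal 0 1)) := by
  apply Real.le_sqrt_of_sq_le
  have h := variance_nonneg (fun x : ℝ => |a + b * x|) (gaussianReal 0 1)
  have hm : MemLp (fun x : ℝ => |a + b * x|) 2 (gaussianReal 0 1) := (gauss_memLp a b).abs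
  rw [variance_eq_sub hm] at h
  simp at h
  exact h

lemma gauss_lower (a b : ℝ) (ha : a ≠ 0) :
    Real.sqrt (2 / Real.pi) * Real.sqrt (a ^ 2 + b ^ 2) < ∫ x, |a + b * x| ∂(gaussianReal 0 1) := by
  by_cases hb : b = 0
  · subst hb
    have h1 : Real.sqrt (2 / Real.pi) < 1 := by
      rw [Real.sqrt_lt' one_pos, div_lt_iff₀ Real.pi_pos]
      linarith [Real.pi_gt_three]
    have h2 : 0 < |a| := abs_pos.2 ha
    simp [Real.sqrt_sq_eq_abs] at h1 ⊢
    nlinarith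
  · have hpt : ∀ x : ℝ, |a + b * x| = |b| * |a / b + x| := by
      intro x
      rw [← abs_mul]; congr 1; field_simp
    simp_rw [hpt]
    rw [integral_const_mul, gauss_abs]
    have h1 := main_ne (div_ne_zero ha hb)
    have h2 : Real.sqrt (a ^ 2 + b ^ 2) = |b| * Real.sqrt (1 + (a / b) ^ 2) := by
      rw [← Real.sqrt_sq_eq_abs, ← Real.sqrt_mul (sq_nonneg b)]
      congr 1; field_simp; ring
    have h3 : 0 < Real.sqrt (2 / Real.pi) := Real.sqrt_pos.2 (div_pos two_pos Real.pi_pos)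
    rw [h2, mul_left_comm]
    have h4 : 0 < |b| := abs_pos.2 hb
    gcongr

lemma gauss_zero (b : ℝ) :
    Real.sqrt (2 / Real.pi) * Real.sqrt (0 ^ 2 + b ^ 2) = ∫ x, |0 + b * x| ∂(gaussianReal 0 1) := by
  have h := gauss_abs 0
  have hpt : ∀ x : ℝ, |0 + b * x| = |b| * |0 + x| := by
    intro x
    rw [← abs_mul]; congr 1; ring
  simp_rw [hpt]
  rw [integral_const_mul, h]
  simp [Real.sqrt_sq_eq_abs, mul_comm]

/-- for `x ~ N(0,1)` and reals `a, b`: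
`√(2/π)·√(E[(a+bx)²]) ≤ E[|a+bx|] ≤ √(E[(a+bx)²])`, with equality in the lower bound
exactly when `a = 0`. -/
theorem stmt8 (a b : ℝ) :
    Real.sqrt (2 / Real.pi) *
        Real.sqrt (∫ x, (a + b * x) ^ 2 ∂(gaussianReal 0 1)) ≤
      (∫ x, |a + b * x| ∂(gaussianReal 0 1)) ∧
    (∫ x, |a + b * x| ∂(gaussianReal 0 1)) ≤
      Real.sqrt (∫ x, (a + b * x) ^ 2 ∂(gaussianReal 0 1)) ∧
    (Real.sqrt (2 / Real.pi) *
        Real.sqrt (∫ x, (a + b * x) ^ 2 ∂(gaussianReal 0 1)) =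
      (∫ x, |a + b * x| ∂(gaussianReal 0 1)) ↔ a = 0) := by
  refine ⟨?_, gauss_upper a b, ?_⟩
  · rw [gauss_sq]
    by_cases ha : a = 0
    · subst ha
      exact (gauss_zero b).le
    · exact (gauss_lower a b ha).le
  · rw [gauss_sq]
    constructor
    · intro h
      by_contra ha
      exact (gauss_lower a b ha).ne h
    · rintro rfl
      exact gauss_zero b
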